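/- For every z ∈ ℂ with θ₁(z|τ) ≠ 0 one has 2 ∑_{n=1}^∞ (12/n) q^{n²/24} cos(nz) = η(τ) · θ₁(2z|τ)/θ₁(z|τ), where (12/n) is the Kronecker symbol, i.e. (12/n) = 1 if n ≡ ±1 (mod 12), (12/n) = −1 if n ≡ ±5 (mod 12), and (12/n) = 0 otherwise. -/

import Mathlib

noncomputable section

open Complex

namespace Liu

/-- `π` as a complex number. -/
def piC : ℂ := Real.pi

/-- The nome `q = exp(2πiτ)`. -/
def qq (τ : ℂ) : ℂ := exp (2 * piC * I * τ)

/-- Jacobi theta function θ₁(z|τ). -/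
def theta1 (z τ : ℂ) : ℂ :=
  -I * exp (piC * I * τ / 4) *
    ∑' n : ℤ, (-1 : ℂ) ^ n * exp (piC * I * τ * (n : ℂ) * ((n : ℂ) + 1)) *
      exp ((2 * (n : ℂ) + 1) * I * z)

/-- Jacobi theta function θ₂(z|τ). -/
def theta2 (z τ : ℂ) : ℂ :=
  2 * ∑' n : ℕ, exp (piC * I * τ * (2 * (n : ℂ) + 1) ^ 2 / 4) * cos ((2 * (n : ℂ) + 1) * z)

/-- Jacobi theta function θ₃(z|τ). -/
def theta3 (z τ : ℂ) : ℂ :=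
  1 + 2 * ∑' n : ℕ, exp (piC * I * τ * ((n : ℂ) + 1) ^ 2) * cos (2 * ((n : ℂ) + 1) * z)

/-- Jacobi theta function θ₄(z|τ). -/
def theta4 (z τ : ℂ) : ℂ :=
  1 + 2 * ∑' n : ℕ, (-1 : ℂ) ^ (n + 1) * exp (piC * I * τ * ((n : ℂ) + 1) ^ 2) *
    cos (2 * ((n : ℂ) + 1) * z)

/-- θ₁'(τ) = (∂θ₁/∂z)(0|τ). -/
def theta1' (τ : ℂ) : ℂ := deriv (fun z => theta1 z τ) 0

/-- The Dedekind eta function. -/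
def eta (τ : ℂ) : ℂ := exp (piC * I * τ / 12) * ∏' n : ℕ, (1 - qq τ ^ (n + 1))

/-- Eisenstein series L = E₂. -/
def EisL (τ : ℂ) : ℂ :=
  1 - 24 * ∑' n : ℕ, ((n : ℂ) + 1) * qq τ ^ (n + 1) / (1 - qq τ ^ (n + 1))

/-- Eisenstein series M = E₄. -/
def EisM (τ : ℂ) : ℂ :=
  1 + 240 * ∑' n : ℕ, ((n : ℂ) + 1) ^ 3 * qq τ ^ (n + 1) / (1 - qq τ ^ (n + 1))

/-- The period lattice Λ = {mπ + nπτ : m, n ∈ ℤ}. -/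
def Lambda (τ : ℂ) : Set ℂ := {z | ∃ m n : ℤ, z = (m : ℂ) * piC + (n : ℂ) * piC * τ}

/-- The Weierstrass ℘ function attached to the lattice with periods π and πτ. -/
def wp (τ z : ℂ) : ℂ :=
  1 / z ^ 2 + ∑' p : ℤ × ℤ,
    if p = (0, 0) then 0
    else 1 / (z - ((p.1 : ℂ) * piC + (p.2 : ℂ) * piC * τ)) ^ 2
      - 1 / ((p.1 : ℂ) * piC + (p.2 : ℂ) * piC * τ) ^ 2

/-- The Kronecker symbol (12/n). -/
def kron12 (n : ℕ) : ℤ :=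
  if n % 12 = 1 ∨ n % 12 = 11 then 1
  else if n % 12 = 5 ∨ n % 12 = 7 then -1
  else 0

open Filter Topology

/-- The **pentagonal number theorem** for a complex number in the open unit disc. -/
theorem tprod_one_sub_pow_eq_tsum_pentagonal {x : ℂ} (hx : ‖x‖ < 1) :
    ∏' n : ℕ, (1 - x ^ (n + 1)) =
      ∑' k : ℕ, (-1) ^ k * (x ^ pentagonal (-k) - x ^ pentagonal (k + 1)) := by
  set r := ‖x‖
  have hr0 : 0 ≤ r := norm_nonneg x
  have hgeom : Summable fun n : ℕ ↦ r ^ n := summable_geometric_of_lt_one hr0 hx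
  have hshift (k : ℕ) : Summable fun n : ℕ ↦ r ^ (n + k + 1) := by
    simpa only [add_assoc] using (summable_nat_add_iff (k + 1)).2 hgeom
  set C := Real.exp (∑' n : ℕ, r ^ n)
  have hprod (k n : ℕ) : ‖∏ i ∈ Finset.range (n + 1), (1 - x ^ (k + i + 1))‖ ≤ C := by
    rw [norm_prod]
    calc ∏ i ∈ Finset.range (n + 1), ‖1 - x ^ (k + i + 1)‖
        ≤ ∏ i ∈ Finset.range (n + 1), (1 + r ^ i) := by
          refine Finset.prod_le_prod (fun _ _ ↦ norm_nonneg _) fun i _ ↦ ?_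
          refine (norm_sub_le _ _).trans ?_
          rw [norm_one, norm_pow]
          gcongr 1 + ?_
          exact pow_le_pow_of_le_one hr0 hx.le (by omega)
      _ ≤ Real.exp (∑ i ∈ Finset.range (n + 1), r ^ i) :=
          Real.prod_one_add_le_exp_sum _ fun _ ↦ pow_nonneg hr0 _
      _ ≤ C := Real.exp_le_exp.2 (hgeom.sum_le_tsum _ fun _ _ ↦ pow_nonneg hr0 _)
  have hterm (k n : ℕ) :
      ‖x ^ ((k + 1) * n) * ∏ i ∈ Finset.range (n + 1), (1 - x ^ (k + i + 1))‖ ≤ r ^ n * C := by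
    rw [norm_mul, norm_pow]
    exact mul_le_mul (pow_le_pow_of_le_one hr0 hx.le (Nat.le_mul_of_pos_left n k.succ_pos))
      (hprod k n) (norm_nonneg _) (pow_nonneg hr0 _)
  refine Pentagonal.tprod_one_sub_pow (tendsto_pow_atTop_nhds_zero_of_norm_lt_one hx)
    (fun k ↦ (hgeom.mul_right C).of_norm_bounded (hterm k)) (fun k ↦ ?_) ?_ ?_
  · simpa only [← sub_eq_add_neg] using
      multipliable_one_add_of_summable (f := fun n ↦ -x ^ (n + k + 1))
        (by simpa only [norm_neg, norm_pow] using hshift k)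
  · refine (hgeom.mul_right 2).of_norm_bounded fun k ↦ ?_
    have h1 : k ≤ pentagonal (-k) := by
      have := two_mul_natCast_pentagonal_neg k
      zify
      nlinarith
    have h2 : k ≤ pentagonal (k + 1) := by
      have := two_mul_natCast_pentagonal (k + 1)
      zify
      nlinarith
    rw [norm_mul, norm_pow, norm_neg, norm_one, one_pow, one_mul, mul_two]
    refine (norm_sub_le _ _).trans ?_
    rw [norm_pow, norm_pow]
    exact add_le_add (pow_le_pow_of_le_one hr0 hx.le h1) (pow_le_pow_of_le_one hr0 hx.le h2)
  · have hlim : Tendsto (fun k : ℕ ↦ r ^ k * ((∑' n : ℕ, r ^ n) * C)) atTop (𝓝 0) := by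
      simpa using (tendsto_pow_atTop_nhds_zero_of_lt_one hr0 hx).mul_const _
    refine squeeze_zero_norm (fun k ↦ ?_) hlim
    rw [norm_mul, norm_mul, norm_pow, norm_neg, norm_one, one_pow, one_mul, norm_pow]
    refine mul_le_mul (pow_le_pow_of_le_one hr0 hx.le ?_)
      (tsum_of_norm_bounded (hgeom.hasSum.mul_right C) (hterm k)) (norm_nonneg _) (pow_nonneg hr0 _)
    rw [Nat.le_div_iff_mul_le two_pos]
    nlinarith

/-- A doubly infinite Gaussian series converges absolutely. -/
theorem summable_norm_exp_quadratic {α : ℂ} (hα : α.re < 0) (β γ : ℂ) :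
    Summable fun n : ℤ ↦ ‖exp (α * n ^ 2 + β * n + γ)‖ := by
  have hpi : (Real.pi : ℂ) ≠ 0 := by exact_mod_cast Real.pi_ne_zero
  have hτ : 0 < (α / (Real.pi * I)).im := by
    have : α / (Real.pi * I) = ((Real.pi⁻¹ : ℝ) : ℂ) * (-I * α) := by
      push_cast
      field_simp
      simp
    rw [this, im_ofReal_mul]
    have := Real.pi_pos
    simpa using mul_neg_of_pos_of_neg (inv_pos.2 this) hα
  have h := ((summable_jacobiTheta₂_term_iff (β / (2 * Real.pi * I)) _).2 hτ).norm.mul_right ‖exp γ‖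
  refine h.congr fun n ↦ ?_
  rw [jacobiTheta₂_term, ← norm_mul, ← exp_add]
  congr 2
  field_simp
  ring

theorem norm_neg_one_zpow_mul (n : ℤ) (x : ℂ) : ‖(-1 : ℂ) ^ n * x‖ = ‖x‖ := by
  simp

/-- A sum over `ℤ` is the sum over even integers plus the sum over odd integers. -/
theorem tsum_int_even_add_odd {f : ℤ → ℂ} (hf : Summable f) :
    ∑' n, f n = ∑' k, f (2 * k) + ∑' k, f (2 * k + 1) := by
  have he : Function.Injective fun k : ℤ ↦ 2 * k := fun a b h ↦ by simpa using h
  have ho : Function.Injective fun k : ℤ ↦ 2 * k + 1 := fun a b h ↦ by simpa using h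
  refine (HasSum.add_isCompl ?_ (he.hasSum_range_iff.2 (hf.comp_injective he).hasSum)
    (ho.hasSum_range_iff.2 (hf.comp_injective ho).hasSum)).tsum_eq
  rw [show Set.range (fun k : ℤ ↦ 2 * k) = {n | Even n} from
      Set.ext fun n ↦ by simp [even_iff_exists_two_mul],
    show Set.range (fun k : ℤ ↦ 2 * k + 1) = {n | Odd n} from
      Set.ext fun n ↦ by simp only [Set.mem_range, Set.mem_ofPred_eq, Odd, eq_comm]]
  exact Int.isCompl_even_odd

theorem re_piC_mul_I_mul_neg {τ : ℂ} (hτ : 0 < τ.im) : (piC * I * τ).re < 0 := by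
  have : (piC * I * τ).re = -(Real.pi * τ.im) := by simp [piC]
  rw [this, neg_lt_zero]
  exact mul_pos Real.pi_pos hτ

/-- Terms of the Gaussian series `∑ q^((12k - 2 + 3l)² / 24)`. -/
def gaussTerm (τ : ℂ) (l k : ℤ) : ℂ :=
  exp (piC * I * τ * (12 * (k : ℂ) - 2 + 3 * l) ^ 2 / 12)

/-- The Gaussian series `∑ q^((12k - 2 + 3l)² / 24)`, summed over `k ∈ ℤ`. -/
def gaussSum (τ : ℂ) (l : ℤ) : ℂ := ∑' k : ℤ, gaussTerm τ l k

theorem gaussSum_add_four (τ : ℂ) (l : ℤ) : gaussSum τ (l + 4) = gaussSum τ l := by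
  rw [gaussSum, gaussSum, ← (Equiv.addRight (1 : ℤ)).tsum_eq (gaussTerm τ l)]
  refine tsum_congr fun k ↦ ?_
  simp only [gaussTerm, Equiv.coe_addRight]
  push_cast
  ring_nf

theorem gaussSum_add_four_mul (τ : ℂ) (l m : ℤ) : gaussSum τ (l + 4 * m) = gaussSum τ l := by
  induction m with
  | zero => simp
  | succ n ih => rw [← ih, ← gaussSum_add_four τ (l + 4 * n)]; ring_nf
  | pred n ih => rw [← ih, ← gaussSum_add_four τ (l + 4 * (-n - 1))]; ring_nf

theorem gaussSum_neg_sub_even (τ : ℂ) (j : ℤ) :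
    gaussSum τ (-(2 * j)) - gaussSum τ (2 * j) = 0 := by
  rw [← gaussSum_add_four_mul τ (-(2 * j)) j, sub_eq_zero]
  ring_nf

theorem gaussSum_neg_sub_odd (τ : ℂ) (j : ℤ) :
    gaussSum τ (-(2 * j + 1)) - gaussSum τ (2 * j + 1) =
      -((-1) ^ j * (gaussSum τ 1 - gaussSum τ (-1))) := by
  obtain ⟨m, rfl | rfl⟩ := Int.even_or_odd' j
  · rw [(even_two_mul m).neg_one_zpow, ← gaussSum_add_four_mul τ 1 m,
      ← gaussSum_add_four_mul τ (-1) (-m)]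
    ring_nf
  · rw [(odd_two_mul_add_one m).neg_one_zpow, ← gaussSum_add_four_mul τ 1 (-m - 1),
      ← gaussSum_add_four_mul τ (-1) (m + 1)]
    ring_nf

theorem norm_qq_lt_one {τ : ℂ} (hτ : 0 < τ.im) : ‖qq τ‖ < 1 := by
  have h := re_piC_mul_I_mul_neg hτ
  rw [qq, norm_exp, Real.exp_lt_one_iff, show 2 * piC * I * τ = ((2 : ℝ) : ℂ) * (piC * I * τ) by
    push_cast; ring, re_ofReal_mul]
  linarith

/-- Terms of Euler's series for `η`. -/
def eulerTerm (τ : ℂ) (m : ℤ) : ℂ :=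
  (-1) ^ m * exp (piC * I * τ * (6 * (m : ℂ) + 1) ^ 2 / 12)

theorem summable_eulerTerm {τ : ℂ} (hτ : 0 < τ.im) : Summable (eulerTerm τ) := by
  have h := re_piC_mul_I_mul_neg hτ
  have h3 : (3 * (piC * I * τ)).re < 0 := by
    rw [show (3 : ℂ) = ((3 : ℝ) : ℂ) by norm_num, re_ofReal_mul]
    linarith
  refine ((summable_norm_exp_quadratic h3 (piC * I * τ)
    (piC * I * τ / 12)).congr fun k ↦ ?_).of_norm
  rw [eulerTerm, norm_neg_one_zpow_mul]
  congr 2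
  ring

/-- Euler's expansion of the Dedekind eta function. -/
theorem eta_eq_tsum_eulerTerm {τ : ℂ} (hτ : 0 < τ.im) : eta τ = ∑' m : ℤ, eulerTerm τ m := by
  rw [eta, tprod_one_sub_pow_eq_tsum_pentagonal (norm_qq_lt_one hτ), ← tsum_mul_left,
    ← tsum_nat_add_neg_add_one (summable_eulerTerm hτ)]
  refine tsum_congr fun k ↦ ?_
  have h1 : (2 * pentagonal (-k) : ℂ) = k * (3 * k + 1) := by
    exact_mod_cast two_mul_natCast_pentagonal_neg k
  have h2 : (2 * pentagonal (k + 1) : ℂ) = (k + 1) * (3 * (k + 1) - 1) := by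
    exact_mod_cast two_mul_natCast_pentagonal (k + 1)
  have hsign : (-1 : ℂ) ^ (-((k : ℤ) + 1)) = -(-1) ^ k := by
    rw [zpow_neg, ← inv_zpow, inv_neg, inv_one]
    exact_mod_cast pow_succ (-1 : ℂ) k |>.trans (mul_neg_one _)
  rw [eulerTerm, eulerTerm, hsign, zpow_natCast, qq, ← exp_nat_mul, ← exp_nat_mul, mul_left_comm,
    mul_sub, ← exp_add, ← exp_add]
  rw [show piC * I * τ / 12 + pentagonal (-k) * (2 * piC * I * τ) =
      piC * I * τ * (6 * ((k : ℤ) : ℂ) + 1) ^ 2 / 12 by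
        push_cast; linear_combination piC * I * τ * h1,
    show piC * I * τ / 12 + pentagonal (k + 1) * (2 * piC * I * τ) =
      piC * I * τ * (6 * ((-((k : ℤ) + 1) : ℤ) : ℂ) + 1) ^ 2 / 12 by
        push_cast; linear_combination piC * I * τ * h2]
  ring

theorem eta_eq_gaussSum_sub {τ : ℂ} (hτ : 0 < τ.im) :
    eta τ = gaussSum τ 1 - gaussSum τ (-1) := by
  rw [eta_eq_tsum_eulerTerm hτ, tsum_int_even_add_odd (summable_eulerTerm hτ), sub_eq_add_neg,
    gaussSum, gaussSum, ← (Equiv.addRight (1 : ℤ)).tsum_eq (gaussTerm τ (-1)), ← tsum_neg]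
  congr 1 <;> refine tsum_congr fun k ↦ ?_
  · rw [eulerTerm, gaussTerm, (even_two_mul k).neg_one_zpow]
    push_cast
    ring_nf
  · rw [eulerTerm, gaussTerm, (odd_two_mul_add_one k).neg_one_zpow, Equiv.coe_addRight]
    push_cast
    ring_nf

/-- Terms of the series defining `theta1`, with the prefactor `-I` left out. -/
def theta1Term (τ z : ℂ) (n : ℤ) : ℂ :=
  (-1) ^ n * exp (piC * I * τ * (2 * (n : ℂ) + 1) ^ 2 / 4) * exp ((2 * (n : ℂ) + 1) * I * z)

/-- Terms of the series `∑ (-1)^k q^((6k - 1)² / 24) e^{i(6k - 1)z}`. -/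
def kronTerm (τ z : ℂ) (k : ℤ) : ℂ :=
  (-1) ^ k * exp (piC * I * τ * (6 * (k : ℂ) - 1) ^ 2 / 12) * exp ((6 * (k : ℂ) - 1) * I * z)

theorem theta1_eq_tsum (z τ : ℂ) : theta1 z τ = -I * ∑' n : ℤ, theta1Term τ z n := by
  rw [theta1, mul_assoc, ← tsum_mul_left]
  congr 1
  refine tsum_congr fun n ↦ ?_
  rw [theta1Term, show piC * I * τ * (2 * (n : ℂ) + 1) ^ 2 / 4 =
    piC * I * τ / 4 + piC * I * τ * n * (n + 1) by ring, exp_add]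
  ring

theorem summable_norm_theta1Term {τ : ℂ} (hτ : 0 < τ.im) (z : ℂ) :
    Summable fun n ↦ ‖theta1Term τ z n‖ := by
  refine (summable_norm_exp_quadratic (re_piC_mul_I_mul_neg hτ) (piC * I * τ + 2 * I * z)
    (piC * I * τ / 4 + I * z)).congr fun n ↦ ?_
  rw [theta1Term, mul_assoc ((-1) ^ n), norm_neg_one_zpow_mul, ← exp_add]
  congr 2
  ring

theorem summable_norm_kronTerm {τ : ℂ} (hτ : 0 < τ.im) (z : ℂ) :
    Summable fun k ↦ ‖kronTerm τ z k‖ := by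
  have h := re_piC_mul_I_mul_neg hτ
  have h3 : (3 * (piC * I * τ)).re < 0 := by
    rw [show (3 : ℂ) = ((3 : ℝ) : ℂ) by norm_num, re_ofReal_mul]
    linarith
  refine (summable_norm_exp_quadratic h3 (-(piC * I * τ) + 6 * I * z)
    (piC * I * τ / 12 - I * z)).congr fun k ↦ ?_
  rw [kronTerm, mul_assoc ((-1) ^ k), norm_neg_one_zpow_mul, ← exp_add]
  congr 2
  ring

theorem two_mul_tsum_kron12 {τ : ℂ} (hτ : 0 < τ.im) (z : ℂ) :
    2 * ∑' n : ℕ, (kron12 (n + 1) : ℂ) *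
        exp (piC * I * τ * ((n : ℂ) + 1) ^ 2 / 12) * cos (((n : ℂ) + 1) * z) =
      ∑' k, kronTerm τ z k + ∑' k, kronTerm τ (-z) k := by
  have hinj : Function.Injective fun k : ℤ ↦ (6 * k - 1).natAbs - 1 := by
    intro a b h
    simp only at h
    omega
  rw [← (summable_norm_kronTerm hτ z).of_norm.tsum_add (summable_norm_kronTerm hτ (-z)).of_norm,
    ← tsum_mul_left, ← hinj.tsum_eq]
  · refine tsum_congr fun k ↦ ?_
    have hpos : (6 * k - 1).natAbs - 1 + 1 = (6 * k - 1).natAbs := by omega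
    have hkron : (kron12 (6 * k - 1).natAbs : ℂ) = (-1) ^ k := by
      obtain ⟨m, rfl | rfl⟩ := Int.even_or_odd' k
      · rw [(even_two_mul m).neg_one_zpow, kron12, if_pos (by omega)]
        simp
      · rw [(odd_two_mul_add_one m).neg_one_zpow, kron12, if_neg (by omega), if_pos (by omega)]
        simp
    have hcast : (((6 * k - 1).natAbs - 1 : ℕ) : ℂ) + 1 = ((6 * k - 1).natAbs : ℂ) := by
      exact_mod_cast hpos
    have habs : ((6 * k - 1).natAbs : ℂ) = 6 * k - 1 ∨
        ((6 * k - 1).natAbs : ℂ) = -(6 * k - 1) := by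
      rw [Nat.cast_natAbs]
      rcases abs_choice (6 * k - 1) with h | h <;> simp [h]
    have hsq : ((6 * k - 1).natAbs : ℂ) ^ 2 = (6 * k - 1) ^ 2 := by
      rcases habs with h | h <;> rw [h]
      ring
    have hcos : cos ((6 * k - 1).natAbs * z) = cos ((6 * k - 1) * z) := by
      rcases habs with h | h <;> rw [h]
      rw [neg_mul, cos_neg]
    simp only [hpos]
    rw [hkron, hcast, hsq, hcos, kronTerm, kronTerm, cos]
    ring_nf
  · intro n hn
    by_contra hr
    apply hn
    have h1 : kron12 (n + 1) = 0 := by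
      rw [kron12, if_neg, if_neg]
      · rintro (h | h)
        · exact hr ⟨((n : ℤ) + 2) / 6, by grind⟩
        · exact hr ⟨-((n : ℤ) / 6), by grind⟩
      · rintro (h | h)
        · exact hr ⟨-((n : ℤ) / 6), by grind⟩
        · exact hr ⟨((n : ℤ) + 2) / 6, by grind⟩
    simp [h1]

/-- The coefficient of the Gaussian series in the product of the two theta series. -/
def outerTerm (τ z : ℂ) (l : ℤ) : ℂ :=
  (-1) ^ l * exp (piC * I * τ * (l : ℂ) ^ 2 / 4) * exp (2 * (l : ℂ) * I * z)

theorem theta1Term_mul_kronTerm (τ z : ℂ) (l k : ℤ) :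
    theta1Term τ z (l - 3 * k) * kronTerm τ z k = outerTerm τ z l * gaussTerm τ (-l) k := by
  have hsign : (-1 : ℂ) ^ (l - 3 * k) * (-1) ^ k = (-1) ^ l := by
    rw [← zpow_add₀ (by norm_num), show l - 3 * k + k = l + 2 * (-k) by ring,
      zpow_add₀ (by norm_num), (even_two_mul _).neg_one_zpow, mul_one]
  have hexp : exp (piC * I * τ * (2 * ((l - 3 * k : ℤ) : ℂ) + 1) ^ 2 / 4) *
      exp ((2 * ((l - 3 * k : ℤ) : ℂ) + 1) * I * z) *
      (exp (piC * I * τ * (6 * (k : ℂ) - 1) ^ 2 / 12) * exp ((6 * (k : ℂ) - 1) * I * z)) =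
      exp (piC * I * τ * (l : ℂ) ^ 2 / 4) * exp (2 * (l : ℂ) * I * z) * gaussTerm τ (-l) k := by
    simp only [gaussTerm, ← exp_add]
    push_cast
    ring_nf
  rw [theta1Term, kronTerm, outerTerm]
  linear_combination congrArg₂ (fun a b : ℂ ↦ a * b) hsign hexp

theorem theta1Term_mul_kronTerm_neg (τ z : ℂ) (l k : ℤ) :
    theta1Term τ z (l + 3 * k - 1) * kronTerm τ (-z) k = -(outerTerm τ z l * gaussTerm τ l k) := by
  have hsign : (-1 : ℂ) ^ (l + 3 * k - 1) * (-1) ^ k = -(-1) ^ l := by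
    rw [← zpow_add₀ (by norm_num), show l + 3 * k - 1 + k = l + (2 * (2 * k - 1) + 1) by ring,
      zpow_add₀ (by norm_num), (odd_two_mul_add_one _).neg_one_zpow, mul_neg_one]
  have hexp : exp (piC * I * τ * (2 * ((l + 3 * k - 1 : ℤ) : ℂ) + 1) ^ 2 / 4) *
      exp ((2 * ((l + 3 * k - 1 : ℤ) : ℂ) + 1) * I * z) *
      (exp (piC * I * τ * (6 * (k : ℂ) - 1) ^ 2 / 12) * exp ((6 * (k : ℂ) - 1) * I * -z)) =
      exp (piC * I * τ * (l : ℂ) ^ 2 / 4) * exp (2 * (l : ℂ) * I * z) * gaussTerm τ l k := by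
    simp only [gaussTerm, ← exp_add]
    push_cast
    ring_nf
  rw [theta1Term, kronTerm, outerTerm]
  linear_combination congrArg₂ (fun a b : ℂ ↦ a * b) hsign hexp

/-- The product of two series over `ℤ` may be summed along the fibres of
`(n, k) ↦ n - e k`. -/
theorem hasSum_tsum_shear {f g : ℤ → ℂ} (hf : Summable fun n ↦ ‖f n‖)
    (hg : Summable fun n ↦ ‖g n‖) (e : ℤ → ℤ) :
    HasSum (fun l ↦ ∑' k, f (l + e k) * g k) ((∑' n, f n) * ∑' k, g k) := by
  let σ : ℤ × ℤ ≃ ℤ × ℤ :=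
    { toFun := fun p ↦ (p.1 + e p.2, p.2)
      invFun := fun p ↦ (p.1 - e p.2, p.2)
      left_inv := fun p ↦ by simp
      right_inv := fun p ↦ by simp }
  have hs : Summable fun p : ℤ × ℤ ↦ f p.1 * g p.2 := summable_mul_of_summable_norm hf hg
  have hσ := σ.summable_iff.2 hs
  rw [tsum_mul_tsum_of_summable_norm hf hg, ← σ.tsum_eq]
  exact hσ.hasSum.prod_fiberwise fun l ↦ (hσ.prod_factor l).hasSum

/-- The quintuple product identity in the form `θ₁(z) · ∑ = η · θ₁(2z)`. -/
theorem theta1_mul_tsum_kronTerm {τ : ℂ} (hτ : 0 < τ.im) (z : ℂ) :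
    theta1 z τ * (∑' k, kronTerm τ z k + ∑' k, kronTerm τ (-z) k) = eta τ * theta1 (2 * z) τ := by
  have hθ := summable_norm_theta1Term hτ z
  have hplus := hasSum_tsum_shear hθ (summable_norm_kronTerm hτ z) fun k ↦ -(3 * k)
  have hminus := hasSum_tsum_shear hθ (summable_norm_kronTerm hτ (-z))
    fun k ↦ 3 * k - 1
  simp only [← sub_eq_add_neg, theta1Term_mul_kronTerm] at hplus
  simp only [← add_sub_assoc, theta1Term_mul_kronTerm_neg] at hminus
  have hsum := hplus.add hminus
  simp only [tsum_neg, tsum_mul_left, ← sub_eq_add_neg, ← mul_sub] at hsum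
  change HasSum (fun l ↦ outerTerm τ z l * (gaussSum τ (-l) - gaussSum τ l)) _ at hsum
  rw [theta1_eq_tsum, theta1_eq_tsum, mul_assoc, mul_add, ← hsum.tsum_eq,
    tsum_int_even_add_odd hsum.summable, mul_left_comm (eta τ), ← tsum_mul_left (a := eta τ)]
  congr 1
  rw [show (fun k ↦ outerTerm τ z (2 * k) * _) = fun _ ↦ 0 from
    funext fun k ↦ mul_eq_zero_of_right _ (gaussSum_neg_sub_even τ k), tsum_zero, zero_add]
  refine tsum_congr fun j ↦ ?_
  refine (congrArg _ (gaussSum_neg_sub_odd τ j)).trans ?_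
  rw [← eta_eq_gaussSum_sub hτ, outerTerm, theta1Term, (odd_two_mul_add_one j).neg_one_zpow]
  push_cast
  ring_nf

theorem statement10 (τ : ℂ) (hτ : 0 < τ.im) (z : ℂ) (hz : theta1 z τ ≠ 0) :
    2 * ∑' n : ℕ, (kron12 (n + 1) : ℂ) *
        exp (piC * I * τ * ((n : ℂ) + 1) ^ 2 / 12) * cos (((n : ℂ) + 1) * z) =
      eta τ * theta1 (2 * z) τ / theta1 z τ := by
  rw [two_mul_tsum_kron12 hτ, eq_div_iff hz, mul_comm, theta1_mul_tsum_kronTerm hτ]
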